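/- arXiv:1512.03716 — 6 statements merged into one kernel-verified Lean document; each statement's English description precedes it below -/
import Mathlib

section
/- Let 𝔄 be a unital (not necessarily commutative) ring, let A, B ∈ 𝔄 be skew-involutions (A² = −1, B² = −1), and let u ∈ 𝔄 commute with A and with B and satisfy (A + B)²·u² = −1. Set C := (A + B)·u. Then C is a skew-involution (C² = −1, so C is invertible with C⁻¹ = −C), and C conjugates A and B into each other: C·A = B·C and C·B = A·C. -/
/-- Let `A`, `B` be skew-involutions in a unital ring, and let `u` commute with `A`
and `B` and satisfy `(A+B)²·u² = -1`.  Then `C := (A+B)·u` is a skew-involution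
(`C² = -1`, so `C` is invertible with inverse `-C`), and `C` conjugates `A` and `B`
into each other: `C·A = B·C` and `C·B = A·C`. -/
theorem geometric_mean_of_skew_involutions {𝔄 : Type*} [Ring 𝔄] (A B u C : 𝔄)
    (hA : A ^ 2 = -1) (hB : B ^ 2 = -1)
    (huA : u * A = A * u) (huB : u * B = B * u)
    (hu : (A + B) ^ 2 * u ^ 2 = -1)
    (hC : C = (A + B) * u) :
    C ^ 2 = -1 ∧ C * (-C) = 1 ∧ (-C) * C = 1 ∧
    C * A = B * C ∧ C * B = A * C := by
  have hu_comm : Commute (A + B) u := (Commute.add_right huA huB).symm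
  have hsq : C ^ 2 = -1 := by rw [hC, hu_comm.mul_pow, hu]
  have hAB : (A + B) * A = B * (A + B) := by
    rw [add_mul, mul_add, ← sq, ← sq, hA, hB, add_comm]
  have hBA : (A + B) * B = A * (A + B) := by
    rw [add_mul, mul_add, ← sq, ← sq, hA, hB, add_comm]
  refine ⟨hsq, ?_, ?_, ?_, ?_⟩
  · rw [mul_neg, ← sq, hsq, neg_neg]
  · rw [neg_mul, ← sq, hsq, neg_neg]
  · rw [hC, mul_assoc, huA, ← mul_assoc, hAB, mul_assoc]
  · rw [hC, mul_assoc, huB, ← mul_assoc, hBA, mul_assoc]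
end

section
/- Let n be a nonempty finite index type and let A, B be n×n complex matrices with Aᴴ = −A, A² = −1, Bᴴ = −B, B² = −1, and A + B invertible. Then for all real numbers λ, μ with λ ≥ 0, μ ≥ 0 and (λ, μ) ≠ (0, 0), the matrix λ•A + μ•B is invertible; indeed (λ•A + μ•B)ᴴ·(λ•A + μ•B) = (λ−μ)²·1 + (λμ)•((A+B)ᴴ·(A+B)) is positive definite. In particular, for every real t the matrix (cos t)²•A⁻¹ + (sin t)²•B⁻¹ = −((cos t)²•A + (sin t)²•B) is invertible. -/
open Matrix
open scoped ComplexOrder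

theorem gram_combination_of_skew_involutions
    {n : Type*} [Fintype n] [DecidableEq n] {A B : Matrix n n ℂ}
    (hA1 : Aᴴ = -A) (hA2 : A * A = -1) (hB1 : Bᴴ = -B) (hB2 : B * B = -1) (a b : ℝ) :
    ((a : ℂ) • A + (b : ℂ) • B)ᴴ * ((a : ℂ) • A + (b : ℂ) • B)
      = ((a : ℂ) - (b : ℂ)) ^ 2 • (1 : Matrix n n ℂ)
        + ((a : ℂ) * (b : ℂ)) • ((A + B)ᴴ * (A + B)) := by
  simp only [conjTranspose_add, conjTranspose_smul, hA1, hB1, RCLike.star_def, Complex.conj_ofReal,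
    add_mul, mul_add, smul_mul_assoc, mul_smul_comm, neg_mul, hA2, hB2, neg_neg]
  module

theorem posDef_sq_sub_smul_one_add_mul_smul_gram
    {n : Type*} [Fintype n] [DecidableEq n] {M : Matrix n n ℂ} (hM : IsUnit M)
    {a b : ℝ} (ha : 0 ≤ a) (hb : 0 ≤ b) (hab : (a, b) ≠ (0, 0)) :
    (((a : ℂ) - (b : ℂ)) ^ 2 • (1 : Matrix n n ℂ) + ((a : ℂ) * (b : ℂ)) • (Mᴴ * M)).PosDef := by
  rcases eq_or_ne a b with rfl | hne
  · have ha' : 0 < a := ha.lt_of_ne fun h => hab (by rw [← h])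
    have hc : (0 : ℂ) < (a : ℂ) * (a : ℂ) := by exact_mod_cast mul_pos ha' ha'
    simpa using (PosDef.conjTranspose_mul_self M (mulVec_injective_of_isUnit hM)).smul hc
  · have hc : (0 : ℂ) < ((a : ℂ) - (b : ℂ)) ^ 2 := by
      exact_mod_cast sq_pos_of_ne_zero (sub_ne_zero.mpr hne)
    have hd : (0 : ℂ) ≤ (a : ℂ) * (b : ℂ) := by exact_mod_cast mul_nonneg ha hb
    exact (PosDef.one.smul hc).add_posSemidef ((posSemidef_conjTranspose_mul_self M).smul hd)

/-- For skew-adjoint unitaries `A`, `B` (`Aᴴ = -A`, `A² = -1`, `Bᴴ = -B`, `B² = -1`)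
with `A + B` invertible, every nontrivial nonnegative combination `λ•A + μ•B` is
invertible, its Gram matrix equals `(λ-μ)²·1 + (λμ)·((A+B)ᴴ(A+B))` and is positive
definite; in particular `(cos t)²•A⁻¹ + (sin t)²•B⁻¹ = -((cos t)²•A + (sin t)²•B)`
is invertible for every real `t`. -/
theorem segment_of_skew_involutions_invertible
    {n : Type*} [Fintype n] [DecidableEq n] [Nonempty n]
    (A B : Matrix n n ℂ)
    (hA1 : Aᴴ = -A) (hA2 : A * A = -1)
    (hB1 : Bᴴ = -B) (hB2 : B * B = -1)
    (hAB : IsUnit (A + B)) :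
    (∀ lam mu : ℝ, 0 ≤ lam → 0 ≤ mu → (lam, mu) ≠ (0, 0) →
      IsUnit ((lam : ℂ) • A + (mu : ℂ) • B) ∧
      ((lam : ℂ) • A + (mu : ℂ) • B)ᴴ * ((lam : ℂ) • A + (mu : ℂ) • B)
        = ((lam : ℂ) - (mu : ℂ)) ^ 2 • (1 : Matrix n n ℂ)
          + ((lam : ℂ) * (mu : ℂ)) • ((A + B)ᴴ * (A + B)) ∧
      (((lam : ℂ) • A + (mu : ℂ) • B)ᴴ * ((lam : ℂ) • A + (mu : ℂ) • B)).PosDef) ∧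
    (∀ t : ℝ,
      (Real.cos t : ℂ) ^ 2 • A⁻¹ + (Real.sin t : ℂ) ^ 2 • B⁻¹
        = -((Real.cos t : ℂ) ^ 2 • A + (Real.sin t : ℂ) ^ 2 • B) ∧
      IsUnit ((Real.cos t : ℂ) ^ 2 • A⁻¹ + (Real.sin t : ℂ) ^ 2 • B⁻¹)) := by
  have main : ∀ lam mu : ℝ, 0 ≤ lam → 0 ≤ mu → (lam, mu) ≠ (0, 0) →
      IsUnit ((lam : ℂ) • A + (mu : ℂ) • B) ∧
      ((lam : ℂ) • A + (mu : ℂ) • B)ᴴ * ((lam : ℂ) • A + (mu : ℂ) • B)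
        = ((lam : ℂ) - (mu : ℂ)) ^ 2 • (1 : Matrix n n ℂ)
          + ((lam : ℂ) * (mu : ℂ)) • ((A + B)ᴴ * (A + B)) ∧
      (((lam : ℂ) • A + (mu : ℂ) • B)ᴴ * ((lam : ℂ) • A + (mu : ℂ) • B)).PosDef := by
    intro lam mu hl hm hne
    have hgram := gram_combination_of_skew_involutions hA1 hA2 hB1 hB2 lam mu
    have hpos := posDef_sq_sub_smul_one_add_mul_smul_gram hAB hl hm hne
    rw [← hgram] at hpos
    exact ⟨isUnit_of_mul_isUnit_right hpos.isUnit, hgram, hpos⟩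
  refine ⟨main, fun t => ?_⟩
  have hAinv : A⁻¹ = -A := inv_eq_right_inv (by rw [mul_neg, hA2, neg_neg])
  have hBinv : B⁻¹ = -B := inv_eq_right_inv (by rw [mul_neg, hB2, neg_neg])
  have heq : (Real.cos t : ℂ) ^ 2 • A⁻¹ + (Real.sin t : ℂ) ^ 2 • B⁻¹
      = -((Real.cos t : ℂ) ^ 2 • A + (Real.sin t : ℂ) ^ 2 • B) := by
    rw [hAinv, hBinv]
    module
  have hne : (Real.cos t ^ 2, Real.sin t ^ 2) ≠ (0, 0) := by
    intro h
    obtain ⟨hc, hs⟩ := Prod.mk.inj h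
    linarith [Real.sin_sq_add_cos_sq t]
  have hunit := (main _ _ (sq_nonneg (Real.cos t)) (sq_nonneg (Real.sin t)) hne).1
  rw [Complex.ofReal_pow, Complex.ofReal_pow] at hunit
  exact ⟨heq, heq ▸ hunit.neg⟩
end

section
/- Let n be a nonempty finite index type, let A, B be positive definite n×n complex matrices, and let G be a positive definite n×n complex matrix satisfying G·A⁻¹·G = B. Then for every real t the matrix (cos t)²•A⁻¹ + (sin t)²•B⁻¹ is positive definite (hence invertible), and (1/(2π)) • ∫₀^{2π} ((cos t)²•A⁻¹ + (sin t)²•B⁻¹)⁻¹ dt = G. -/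
open Matrix MeasureTheory
open scoped ComplexOrder

attribute [local instance] Matrix.normedAddCommGroup Matrix.normedSpace

lemma hasDerivAt_add_arctan_sin_mul_cos_div {d : ℝ} (hd : 0 < d) (t : ℝ) :
    HasDerivAt
      (fun t => t + Real.arctan
        ((1 - d) * (Real.sin t * Real.cos t) / (d * Real.cos t ^ 2 + Real.sin t ^ 2)))
      (Real.cos t ^ 2 * d + Real.sin t ^ 2 * d⁻¹)⁻¹ t := by
  have hpos (a : ℝ) (ha : 0 < a) : 0 < a * Real.cos t ^ 2 + Real.sin t ^ 2 := by
    rcases eq_or_ne (Real.cos t) 0 with h | h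
    · have := Real.sin_sq_add_cos_sq t
      rw [h] at this ⊢
      nlinarith
    · positivity
  have h₁ := hpos d hd
  have h₂ := hpos (d ^ 2) (by positivity)
  have hden := (((Real.hasDerivAt_cos t).pow 2).const_mul d).add ((Real.hasDerivAt_sin t).pow 2)
  have hnum := ((Real.hasDerivAt_sin t).mul (Real.hasDerivAt_cos t)).const_mul (1 - d)
  refine ((hasDerivAt_id' t).add (hnum.div hden h₁.ne').arctan).congr_deriv ?_
  have hsc := Real.sin_sq_add_cos_sq t
  simp only [Pi.add_apply, Pi.div_apply, Pi.mul_apply, Pi.pow_apply]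
  generalize Real.sin t = s at *
  generalize Real.cos t = c at *
  have h₃ : (d * c ^ 2 + s ^ 2) ^ 2 + ((1 - d) * (s * c)) ^ 2 = d ^ 2 * c ^ 2 + s ^ 2 := by
    linear_combination (d ^ 2 * c ^ 2 + s ^ 2) * hsc
  have h₄ : c ^ 2 * d + s ^ 2 * d⁻¹ = (d ^ 2 * c ^ 2 + s ^ 2) / d := by
    field_simp
  have h₅ : 1 + ((1 - d) * (s * c) / (d * c ^ 2 + s ^ 2)) ^ 2
      = (d ^ 2 * c ^ 2 + s ^ 2) / (d * c ^ 2 + s ^ 2) ^ 2 := by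
    rw [← h₃]; field_simp
  rw [h₄, h₅]
  field_simp
  have hs : s ^ 2 = 1 - c ^ 2 := by linear_combination hsc
  ring_nf
  simp only [show s ^ 4 = (s ^ 2) ^ 2 by ring, hs]
  ring

lemma cos_sq_mul_add_sin_sq_mul_inv_pos {d : ℝ} (hd : 0 < d) (t : ℝ) :
    0 < Real.cos t ^ 2 * d + Real.sin t ^ 2 * d⁻¹ := by
  rcases eq_or_ne (Real.cos t) 0 with h | h
  · have hs := Real.sin_sq_add_cos_sq t
    have : Real.sin t ^ 2 = 1 := by simpa [h] using hs
    rw [h, this]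
    positivity
  · positivity

lemma continuous_inv_cos_sq_mul_add_sin_sq_mul_inv {d : ℝ} (hd : 0 < d) :
    Continuous fun t : ℝ => (Real.cos t ^ 2 * d + Real.sin t ^ 2 * d⁻¹)⁻¹ :=
  Continuous.inv₀ (by fun_prop) fun t => (cos_sq_mul_add_sin_sq_mul_inv_pos hd t).ne'

lemma integral_inv_cos_sq_mul_add_sin_sq_mul_inv {d : ℝ} (hd : 0 < d) :
    ∫ t in (0 : ℝ)..(2 * Real.pi), (Real.cos t ^ 2 * d + Real.sin t ^ 2 * d⁻¹)⁻¹
      = 2 * Real.pi := by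
  rw [intervalIntegral.integral_eq_sub_of_hasDerivAt
    (fun t _ => hasDerivAt_add_arctan_sin_mul_cos_div hd t)
    ((continuous_inv_cos_sq_mul_add_sin_sq_mul_inv hd).intervalIntegrable _ _)]
  simp

lemma integral_sum_smul_const {ι E : Type*} [Fintype ι] [NormedAddCommGroup E] [NormedSpace ℝ E]
    [CompleteSpace E]
    {f : ι → ℝ → ℝ} {a b : ℝ} {v : ι → E} (hf : ∀ i, IntervalIntegrable (f i) volume a b) :
    ∫ t in a..b, ∑ i, f i t • v i = ∑ i, (∫ t in a..b, f i t) • v i := by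
  rw [intervalIntegral.integral_finsetSum fun i _ =>
    ⟨(hf i).1.smul_const (v i), (hf i).2.smul_const (v i)⟩]
  simp_rw [intervalIntegral.integral_smul_const]

lemma Matrix.IsHermitian.exists_unitary_diagonalization
    {n : Type*} [Fintype n] [DecidableEq n] {H : Matrix n n ℂ} (hH : H.IsHermitian) :
    ∃ U : Matrix n n ℂ, U * Uᴴ = 1 ∧ Uᴴ * U = 1 ∧
      H = U * diagonal (fun i => (hH.eigenvalues i : ℂ)) * Uᴴ :=
  ⟨hH.eigenvectorUnitary, Unitary.coe_mul_star_self hH.eigenvectorUnitary,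
    Unitary.coe_star_mul_self hH.eigenvectorUnitary,
    hH.spectral_theorem.trans (Unitary.conjStarAlgAut_apply _ _)⟩

open scoped MatrixOrder Matrix.Norms.L2Operator in
lemma Matrix.PosDef.exists_isUnit_eq_mul_conjTranspose
    {n : Type*} [Fintype n] [DecidableEq n] {G : Matrix n n ℂ} (hG : G.PosDef) :
    ∃ C : Matrix n n ℂ, IsUnit C ∧ G = C * Cᴴ := by
  obtain ⟨C, hC, h⟩ :=
    CStarAlgebra.isStrictlyPositive_iff_eq_star_mul_self.mp hG.isStrictlyPositive
  exact ⟨Cᴴ, hC.star, by rw [h, conjTranspose_conjTranspose, star_eq_conjTranspose]⟩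

/-- Two positive definite matrices are simultaneously diagonalized by a congruence that turns
the first one into the identity. -/
lemma Matrix.PosDef.exists_simultaneous_diagonalization
    {n : Type*} [Fintype n] [DecidableEq n] {G A : Matrix n n ℂ}
    (hG : G.PosDef) (hA : A.PosDef) :
    ∃ (S : Matrix n n ℂ) (d : n → ℝ), IsUnit S ∧ (∀ i, 0 < d i) ∧ G = S * Sᴴ ∧
      Sᴴ * A * S = diagonal fun i => (d i : ℂ) := by
  obtain ⟨C, hC, rfl⟩ := hG.exists_isUnit_eq_mul_conjTranspose
  have hH : (Cᴴ * A * C).PosDef :=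
    hA.conjTranspose_mul_mul_same (mulVec_injective_of_isUnit hC)
  obtain ⟨U, hU, hU', h⟩ := hH.1.exists_unitary_diagonalization
  refine ⟨C * U, hH.1.eigenvalues, hC.mul (IsUnit.of_mul_eq_one _ hU), hH.eigenvalues_pos, ?_, ?_⟩
  · rw [conjTranspose_mul, Matrix.mul_assoc, ← Matrix.mul_assoc U, hU, Matrix.one_mul]
  · calc (C * U)ᴴ * A * (C * U) = Uᴴ * (Cᴴ * A * C) * U := by
          simp only [conjTranspose_mul, Matrix.mul_assoc]
      _ = (Uᴴ * U) * diagonal (fun i => (hH.1.eigenvalues i : ℂ)) * (Uᴴ * U) := by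
          conv_lhs => rw [h]
          simp only [Matrix.mul_assoc]
      _ = _ := by rw [hU', Matrix.one_mul, Matrix.mul_one]

/-- For positive definite matrices `A`, `B` and a positive definite `G` solving the
Riccati equation `G·A⁻¹·G = B`, the integrand `(cos t)²A⁻¹ + (sin t)²B⁻¹` is
positive definite (hence invertible) for every real `t`, and the geometric mean
integral `(1/2π)∫₀^{2π} ((cos t)²A⁻¹ + (sin t)²B⁻¹)⁻¹ dt` equals `G`. -/
theorem geometric_mean_integral_eq_riccati_solution
    {n : Type*} [Fintype n] [DecidableEq n] [Nonempty n]
    (A B G : Matrix n n ℂ)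
    (hA : A.PosDef) (hB : B.PosDef) (hG : G.PosDef)
    (hRic : G * A⁻¹ * G = B) :
    (∀ t : ℝ,
      ((Real.cos t : ℂ) ^ 2 • A⁻¹ + (Real.sin t : ℂ) ^ 2 • B⁻¹).PosDef ∧
      IsUnit ((Real.cos t : ℂ) ^ 2 • A⁻¹ + (Real.sin t : ℂ) ^ 2 • B⁻¹)) ∧
    (1 / (2 * Real.pi)) •
        (∫ t in (0 : ℝ)..(2 * Real.pi),
          ((Real.cos t : ℂ) ^ 2 • A⁻¹ + (Real.sin t : ℂ) ^ 2 • B⁻¹)⁻¹)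
      = G := by
  obtain ⟨S, d, hS, hd, hGS, hAS⟩ := hG.exists_simultaneous_diagonalization hA.inv
  have hS₁ : S * S⁻¹ = 1 := mul_nonsing_inv S ((isUnit_iff_isUnit_det S).1 hS)
  have hS₂ : S⁻¹ * S = 1 := nonsing_inv_mul S ((isUnit_iff_isUnit_det S).1 hS)
  have hS₁' : (S⁻¹)ᴴ * Sᴴ = 1 := by rw [← conjTranspose_mul, hS₁, conjTranspose_one]
  have hS₂' : Sᴴ * (S⁻¹)ᴴ = 1 := by rw [← conjTranspose_mul, hS₂, conjTranspose_one]
  have hA' : A⁻¹ = (S⁻¹)ᴴ * diagonal (fun i => (d i : ℂ)) * S⁻¹ := by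
    calc A⁻¹ = ((S⁻¹)ᴴ * Sᴴ) * A⁻¹ * (S * S⁻¹) := by rw [hS₁, hS₁']; simp
      _ = _ := by rw [← hAS]; simp only [Matrix.mul_assoc]
  have hB' : B⁻¹ = (S⁻¹)ᴴ * diagonal (fun i => ((d i)⁻¹ : ℂ)) * S⁻¹ := by
    apply inv_eq_left_inv
    have hdd : diagonal (fun i => ((d i)⁻¹ : ℂ)) * diagonal (fun i => (d i : ℂ)) = 1 := by
      rw [diagonal_mul_diagonal, ← diagonal_one]
      congr 1; ext i
      exact inv_mul_cancel₀ (by exact_mod_cast (hd i).ne')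
    calc _ = (S⁻¹)ᴴ * (diagonal (fun i => ((d i)⁻¹ : ℂ)) * ((S⁻¹ * S) * (Sᴴ * A⁻¹ * S))) * Sᴴ := by
          rw [← hRic, hGS]; simp only [Matrix.mul_assoc]
      _ = 1 := by rw [hS₂, hAS, Matrix.one_mul, hdd, Matrix.mul_one, hS₁']
  have hsum (t : ℝ) : (Real.cos t : ℂ) ^ 2 • A⁻¹ + (Real.sin t : ℂ) ^ 2 • B⁻¹ = (S⁻¹)ᴴ *
      diagonal (fun i => ((Real.cos t ^ 2 * d i + Real.sin t ^ 2 * (d i)⁻¹ : ℝ) : ℂ)) * S⁻¹ := by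
    have hdiag : diagonal (fun i => ((Real.cos t ^ 2 * d i + Real.sin t ^ 2 * (d i)⁻¹ : ℝ) : ℂ))
        = (Real.cos t : ℂ) ^ 2 • diagonal (fun i => (d i : ℂ))
          + (Real.sin t : ℂ) ^ 2 • diagonal (fun i => ((d i)⁻¹ : ℂ)) := by
      rw [← diagonal_smul, ← diagonal_smul, diagonal_add]
      congr 1; ext i
      simp
    rw [hA', hB', hdiag]
    simp only [Matrix.mul_add, Matrix.add_mul, Matrix.mul_smul, Matrix.smul_mul]
  have hpd (t : ℝ) : ((Real.cos t : ℂ) ^ 2 • A⁻¹ + (Real.sin t : ℂ) ^ 2 • B⁻¹).PosDef := by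
    rw [hsum]
    refine PosDef.conjTranspose_mul_mul_same (PosDef.diagonal fun i => ?_)
      (mulVec_injective_of_isUnit (IsUnit.of_mul_eq_one _ hS₂))
    exact_mod_cast cos_sq_mul_add_sin_sq_mul_inv_pos (hd i) t
  refine ⟨fun t => ⟨hpd t, (hpd t).isUnit⟩, ?_⟩
  have hinv (t : ℝ) : ((Real.cos t : ℂ) ^ 2 • A⁻¹ + (Real.sin t : ℂ) ^ 2 • B⁻¹)⁻¹ =
      ∑ i, (Real.cos t ^ 2 * d i + Real.sin t ^ 2 * (d i)⁻¹)⁻¹ • (S * single i i 1 * Sᴴ) := by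
    have hdiag : ∑ i, (Real.cos t ^ 2 * d i + Real.sin t ^ 2 * (d i)⁻¹)⁻¹ • (S * single i i 1 * Sᴴ)
        = S * diagonal
          (fun i => (((Real.cos t ^ 2 * d i + Real.sin t ^ 2 * (d i)⁻¹)⁻¹ : ℝ) : ℂ)) * Sᴴ := by
      rw [← sum_single_eq_diagonal, Matrix.mul_sum, Matrix.sum_mul]
      refine Finset.sum_congr rfl fun i _ => ?_
      rw [← Matrix.smul_mul, ← Matrix.mul_smul, smul_single, Complex.real_smul, mul_one]
    rw [hdiag, hsum]
    apply inv_eq_left_inv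
    set D := diagonal (fun i => ((Real.cos t ^ 2 * d i + Real.sin t ^ 2 * (d i)⁻¹ : ℝ) : ℂ))
    set E := diagonal
      (fun i => (((Real.cos t ^ 2 * d i + Real.sin t ^ 2 * (d i)⁻¹)⁻¹ : ℝ) : ℂ))
    have hED : E * D = 1 := by
      rw [diagonal_mul_diagonal, ← diagonal_one]
      congr 1; ext i
      rw [← Complex.ofReal_mul, inv_mul_cancel₀ (cos_sq_mul_add_sin_sq_mul_inv_pos (hd i) t).ne',
        Complex.ofReal_one]
    calc _ = S * (E * ((Sᴴ * (S⁻¹)ᴴ) * D)) * S⁻¹ := by simp only [Matrix.mul_assoc]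
      _ = 1 := by rw [hS₂', Matrix.one_mul, hED, Matrix.mul_one, hS₁]
  simp_rw [hinv]
  rw [integral_sum_smul_const fun i =>
    (continuous_inv_cos_sq_mul_add_sin_sq_mul_inv (hd i)).intervalIntegrable _ _]
  simp_rw [integral_inv_cos_sq_mul_add_sin_sq_mul_inv (hd _)]
  rw [← Finset.smul_sum, smul_smul, one_div, inv_mul_cancel₀ (by positivity), one_smul,
    ← Matrix.sum_mul, ← Matrix.mul_sum, sum_single_eq_diagonal, diagonal_one, Matrix.mul_one, hGS]
end

section
/- Let n be a nonempty finite index type and let A, B be positive definite n×n complex matrices. If G₁ and G₂ are positive definite n×n complex matrices with G₁·A⁻¹·G₁ = B and G₂·A⁻¹·G₂ = B, then G₁ = G₂. That is, the Riccati equation G·A⁻¹·G = B has at most one positive definite solution. -/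
open Matrix
open scoped ComplexOrder

/-- Uniqueness of the positive definite solution of the Riccati equation
`G·A⁻¹·G = B` for positive definite `A`, `B`. -/
theorem riccati_posDef_solution_unique
    {n : Type*} [Fintype n] [DecidableEq n] [Nonempty n]
    (A B G₁ G₂ : Matrix n n ℂ) (hA : A.PosDef) (hB : B.PosDef)
    (h₁ : G₁.PosDef) (h₂ : G₂.PosDef)
    (e₁ : G₁ * A⁻¹ * G₁ = B) (e₂ : G₂ * A⁻¹ * G₂ = B) :
    G₁ = G₂ := by
  open scoped MatrixOrder Matrix.Norms.L2Operator in
  have hA' : 0 ≤ A⁻¹ := hA.inv.posSemidef.nonneg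
  obtain ⟨S, hS, hSS⟩ : ∃ S : Matrix n n ℂ, 0 ≤ S ∧ S * S = A⁻¹ :=
    ⟨CFC.sqrt A⁻¹, CFC.sqrt_nonneg _, CFC.sqrt_mul_sqrt_self _ hA'⟩
  have hSu : IsUnit S := by
    have h : IsUnit (S * S) := hSS ▸ hA.inv.isUnit
    exact isUnit_of_mul_isUnit_left h
  have hSh : Sᴴ = S := hS.posSemidef.isHermitian
  have nonneg_conj : ∀ G : Matrix n n ℂ, G.PosDef → 0 ≤ S * G * S := fun G hG => by
    simpa [hSh] using (hG.posSemidef.conjTranspose_mul_mul_same S).nonneg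
  have sq_conj : ∀ G : Matrix n n ℂ, G * A⁻¹ * G = B → (S * G * S) ^ 2 = S * B * S :=
    fun G hG => by rw [← hG, ← hSS]; noncomm_ring
  have h : S * G₁ * S = S * G₂ * S :=
    (CFC.sq_eq_sq_iff _ _ (nonneg_conj G₁ h₁) (nonneg_conj G₂ h₂)).1
      ((sq_conj G₁ e₁).trans (sq_conj G₂ e₂).symm)
  exact hSu.mul_left_cancel (hSu.mul_right_cancel h)
end

section
/- Let 𝔄 be a unital associative algebra over ℝ and let P, A₁, A₂, S ∈ 𝔄 satisfy: P² = −1, P·A₁ = −A₁·P, P·A₂ = −A₂·P, S is invertible, S commutes with P and with A₁ − P·A₂, and 4·S² = −(A₁ − P·A₂)². Set Q₁ := ½·(A₁ − P·A₂)·S⁻¹ and Q₂ := ½·(A₂ + P·A₁)·S⁻¹. Then (Q₁, Q₂) is a Clifford system: Q₁² = −1, Q₂² = −1, and Q₁·Q₂ + Q₂·Q₁ = 0; moreover Q₁·Q₂ = P, both Q₁ and Q₂ anticommute with P, and both Q₁ and Q₂ commute with S. -/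
/-- Two anticommuting square roots `P`, `Q` of `-1` yield the Clifford system `(Q, P * Q)`,
whose product is `P`. -/
theorem clifford_system_of_anticomm {R : Type*} [Ring R] {P Q : R}
    (hP : P * P = -1) (hQ : Q * Q = -1) (h : P * Q = -(Q * P)) :
    (P * Q) * (P * Q) = -1 ∧ Q * (P * Q) + (P * Q) * Q = 0 ∧ Q * (P * Q) = P ∧
    P * (P * Q) = -((P * Q) * P) := by
  have hQP : Q * P = -(P * Q) := by rw [h, neg_neg]
  have hQPQ : Q * (P * Q) = P := by
    rw [← mul_assoc, hQP, neg_mul, mul_assoc, hQ, mul_neg, mul_one, neg_neg]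
  refine ⟨?_, ?_, hQPQ, ?_⟩
  · rw [mul_assoc, hQPQ, hP]
  · rw [hQPQ, mul_assoc, hQ, mul_neg, mul_one, add_neg_cancel]
  · rw [mul_assoc, hQP, mul_neg, neg_neg]

/-- The normalization `½ D S⁻¹` of an element with `4 S² = -D²` squares to `-1`. -/
theorem half_smul_mul_invOf_mul_self {R : Type*} [Ring R] [Algebra ℝ R] {D S : R} [Invertible S]
    (hSD : Commute S D) (hS : (4 : ℝ) • (S * S) = -(D * D)) :
    ((1 / 2 : ℝ) • (D * ⅟S)) * ((1 / 2 : ℝ) • (D * ⅟S)) = -1 := by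
  have hDD : D * D = -((4 : ℝ) • (S * S)) := by rw [hS, neg_neg]
  have hSS : S * S * (⅟S * ⅟S) = 1 := by
    rw [mul_assoc, mul_invOf_cancel_left, mul_invOf_self]
  rw [smul_mul_smul_comm, (hSD.invOf_left).mul_mul_mul_comm, hDD, neg_mul, smul_mul_assoc, hSS,
    smul_neg, smul_smul]
  norm_num


/-- Monoaxial decomposition, first part: let `P, A₁, A₂, S` lie in a unital
associative `ℝ`-algebra with `P² = -1`, `P` anticommuting with `A₁` and `A₂`,
`S` invertible, commuting with `P` and with `A₁ - P·A₂`, and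
`4·S² = -(A₁ - P·A₂)²`.  Then `Q₁ := ½·(A₁ - P·A₂)·S⁻¹` and
`Q₂ := ½·(A₂ + P·A₁)·S⁻¹` form a Clifford system (`Q₁² = Q₂² = -1`,
`Q₁Q₂ + Q₂Q₁ = 0`), `Q₁·Q₂ = P`, both `Qᵢ` anticommute with `P`, and both
`Qᵢ` commute with `S`. -/
theorem monoaxial_clifford_system {𝔄 : Type*} [Ring 𝔄] [Algebra ℝ 𝔄]
    (P A₁ A₂ S : 𝔄) [Invertible S]
    (hP : P ^ 2 = -1)
    (h₁ : P * A₁ = -(A₁ * P)) (h₂ : P * A₂ = -(A₂ * P))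
    (hSP : S * P = P * S)
    (hSD : S * (A₁ - P * A₂) = (A₁ - P * A₂) * S)
    (hS2 : (4 : ℝ) • (S * S) = -((A₁ - P * A₂) * (A₁ - P * A₂)))
    (Q₁ Q₂ : 𝔄)
    (hQ₁ : Q₁ = (1 / 2 : ℝ) • ((A₁ - P * A₂) * ⅟S))
    (hQ₂ : Q₂ = (1 / 2 : ℝ) • ((A₂ + P * A₁) * ⅟S)) :
    Q₁ * Q₁ = -1 ∧ Q₂ * Q₂ = -1 ∧ Q₁ * Q₂ + Q₂ * Q₁ = 0 ∧
    Q₁ * Q₂ = P ∧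
    P * Q₁ = -(Q₁ * P) ∧ P * Q₂ = -(Q₂ * P) ∧
    Q₁ * S = S * Q₁ ∧ Q₂ * S = S * Q₂ := by
  have hPP : P * P = -1 := by rw [← sq, hP]
  have hPD : P * (A₁ - P * A₂) = A₂ + P * A₁ := by
    rw [mul_sub, ← mul_assoc P P, hPP, neg_one_mul, sub_neg_eq_add, add_comm]
  have hDP : (A₁ - P * A₂) * P = -(A₂ + P * A₁) := by
    have h₂' : A₂ * P = -(P * A₂) := by rw [h₂, neg_neg]
    rw [sub_mul, mul_assoc P A₂, h₂', mul_neg, ← mul_assoc, hPP, neg_one_mul, h₁]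
    abel
  have hQ₂' : Q₂ = P * Q₁ := by rw [hQ₂, hQ₁, ← hPD, mul_smul_comm, mul_assoc]
  have hSP' : Commute S P := hSP
  have hSD' : Commute S (A₁ - P * A₂) := hSD
  have hQQ : Q₁ * Q₁ = -1 := hQ₁ ▸ half_smul_mul_invOf_mul_self hSD' hS2
  have hPQ : P * Q₁ = -(Q₁ * P) := by
    rw [← hQ₂', hQ₂, hQ₁, smul_mul_assoc, mul_assoc, hSP'.invOf_left.eq, ← mul_assoc, hDP,
      neg_mul, smul_neg, neg_neg]
  have hSQ : Commute S Q₁ := by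
    rw [hQ₁]
    exact (hSD'.mul_right (Commute.refl S).invOf_right).smul_right _
  obtain ⟨hsq, hanti, hmul, hP₂⟩ := clifford_system_of_anticomm hPP hQQ hPQ
  rw [hQ₂']
  exact ⟨hQQ, hsq, hanti, hmul, hPQ, hP₂, hSQ.symm.eq, (hSP'.mul_right hSQ).symm.eq⟩
end

section
/- Let 𝔄 be a unital associative algebra over ℝ and let P, A₁, A₂, S ∈ 𝔄 satisfy: P² = −1, P·A₁ = −A₁·P, P·A₂ = −A₂·P, S is invertible, S commutes with P and with A₁ − P·A₂, and 4·S² = −(A₁ − P·A₂)². Set Q₁ := ½·(A₁ − P·A₂)·S⁻¹, Q₂ := ½·(A₂ + P·A₁)·S⁻¹, and r := ½·(A₂·Q₂ − A₁·Q₁). Then the circular decomposition holds: A₁ = (S + r)·Q₁ and A₂ = (S − r)·Q₂; moreover r commutes with P. -/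
/-- Monoaxial decomposition, second part (circular decomposition): with
`P, A₁, A₂, S` as in the Clifford-system theorem and
`Q₁ := ½·(A₁ - P·A₂)·S⁻¹`, `Q₂ := ½·(A₂ + P·A₁)·S⁻¹`,
`r := ½·(A₂·Q₂ - A₁·Q₁)`, one has `A₁ = (S + r)·Q₁`, `A₂ = (S - r)·Q₂`,
and `r` commutes with `P`. -/
theorem monoaxial_circular_decomposition {𝔄 : Type*} [Ring 𝔄] [Algebra ℝ 𝔄]
    (P A₁ A₂ S : 𝔄) [Invertible S]
    (hP : P ^ 2 = -1)
    (h₁ : P * A₁ = -(A₁ * P)) (h₂ : P * A₂ = -(A₂ * P))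
    (hSP : S * P = P * S)
    (hSD : S * (A₁ - P * A₂) = (A₁ - P * A₂) * S)
    (hS2 : (4 : ℝ) • (S * S) = -((A₁ - P * A₂) * (A₁ - P * A₂)))
    (Q₁ Q₂ r : 𝔄)
    (hQ₁ : Q₁ = (1 / 2 : ℝ) • ((A₁ - P * A₂) * ⅟S))
    (hQ₂ : Q₂ = (1 / 2 : ℝ) • ((A₂ + P * A₁) * ⅟S))
    (hr : r = (1 / 2 : ℝ) • (A₂ * Q₂ - A₁ * Q₁)) :
    A₁ = (S + r) * Q₁ ∧ A₂ = (S - r) * Q₂ ∧ r * P = P * r := by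
  have hPP : P * P = -1 := by rw [← sq, hP]
  have hPP' (x : 𝔄) : P * (P * x) = -x := by rw [← mul_assoc, hPP, neg_one_mul]
  have hPA₂P : P * A₂ * P = A₂ := by
    rw [mul_assoc, ← neg_eq_iff_eq_neg.mpr h₂, mul_neg, hPP', neg_neg]
  obtain ⟨D, hD⟩ : ∃ D, D = A₁ - P * A₂ := ⟨_, rfl⟩
  obtain ⟨E, hE⟩ : ∃ E, E = A₁ + P * A₂ := ⟨_, rfl⟩
  have hPD : P * D = A₂ + P * A₁ := by rw [hD, mul_sub, hPP']; abel
  have hDP : P * D = -(D * P) := by rw [hPD, hD, sub_mul, hPA₂P, h₁]; abel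
  have hEP : P * E = -(E * P) := by rw [hE, mul_add, add_mul, hPP', hPA₂P, h₁]; abel
  rw [← hD] at hSD hS2 hQ₁
  rw [← hPD, mul_assoc, ← mul_smul_comm, ← hQ₁] at hQ₂
  have hTP : ⅟S * P = P * ⅟S := (Commute.invOf_left (show Commute S P from hSP)).eq
  have hTD : ⅟S * D = D * ⅟S := (Commute.invOf_left (show Commute S D from hSD)).eq
  have hQP : P * Q₁ = -(Q₁ * P) := by
    rw [hQ₁, mul_smul_comm, smul_mul_assoc, ← mul_assoc, hDP, mul_assoc D, hTP, neg_mul,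
      smul_neg, mul_assoc]
  have hDD : D * D = -((4 : ℝ) • (S * S)) := by rw [hS2, neg_neg]
  have hQQ : Q₁ * Q₁ = -1 := by
    have h : D * ⅟S * (D * ⅟S) = -((4 : ℝ) • (1 : 𝔄)) := by
      rw [mul_assoc, ← mul_assoc (⅟S), hTD, ← mul_assoc, ← mul_assoc, hDD]
      simp [mul_assoc]
    rw [hQ₁, smul_mul_smul_comm, h]
    module
  have hSQ : S * Q₁ = (1 / 2 : ℝ) • D := by
    rw [hQ₁, mul_smul_comm, ← mul_assoc, hSD, mul_assoc, mul_invOf_self, mul_one]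
  have hrE : r = -((1 / 2 : ℝ) • (E * Q₁)) := by
    rw [hr, hQ₂, ← mul_assoc, ← neg_eq_iff_eq_neg.mpr h₂, hE, add_mul, neg_mul]
    module
  have hrQ : r * Q₁ = (1 / 2 : ℝ) • E := by
    rw [hrE, neg_mul, smul_mul_assoc, mul_assoc, hQQ, mul_neg_one, smul_neg, neg_neg]
  have hrP : r * P = P * r := by
    rw [hrE, neg_mul, mul_neg, smul_mul_assoc, mul_smul_comm, ← mul_assoc P, hEP, neg_mul,
      mul_assoc E P, hQP, mul_neg, neg_neg, mul_assoc]
  refine ⟨?_, ?_, hrP⟩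
  · rw [add_mul, hSQ, hrQ, hD, hE]
    module
  · rw [hQ₂, ← mul_assoc, sub_mul, hSP, hrP, ← mul_sub, mul_assoc, sub_mul, hSQ, hrQ, ← smul_sub,
      mul_smul_comm, mul_sub, hPD, hE, mul_add, hPP']
    module
end
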